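/- Every orthogonal transformation T of ℝ^{p,q} can be expressed as the composition of at most 2n reflections with respect to hyperplanes, where n = p + q: there exist k ≤ 2n and invertible vectors s_1, …, s_k such that T = φ_{s_1} ∘ φ_{s_2} ∘ ⋯ ∘ φ_{s_k} (where the empty composition, k = 0, is the identity). -/

import Mathlib

/-- The standard bilinear form of signature `(p, q)` on `ℝ^(p+q)`:
`B x y = ∑_{i < p} x i * y i - ∑_{p ≤ i < p+q} x i * y i`. -/
noncomputable def Bpq (p q : ℕ) : LinearMap.BilinForm ℝ (Fin (p + q) → ℝ) :=
  LinearMap.mk₂ ℝ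
    (fun x y => ∑ i : Fin (p + q), (if i.val < p then (1 : ℝ) else -1) * (x i * y i))
    (fun x x' y => by simp [add_mul, mul_add, Finset.sum_add_distrib])
    (fun c x y => by simp [Finset.mul_sum]; congr 1; funext i; ring_nf)
    (fun x y y' => by simp [add_mul, mul_add, Finset.sum_add_distrib])
    (fun c x y => by simp [Finset.mul_sum]; congr 1; funext i; ring_nf)

/-- The reflection with respect to the hyperplane orthogonal to `s`:
`φ_s x = x - (2 * B x s / B s s) • s`. -/
noncomputable def reflpq (p q : ℕ) (s x : Fin (p + q) → ℝ) : Fin (p + q) → ℝ :=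
  x - (2 * Bpq p q x s / Bpq p q s s) • s

theorem Bpq_symm (p q : ℕ) (x y : Fin (p + q) → ℝ) : Bpq p q x y = Bpq p q y x := by
  simp only [Bpq, LinearMap.mk₂_apply]
  exact Finset.sum_congr rfl fun i _ => by ring

theorem Bpq_single (p q : ℕ) (i j : Fin (p + q)) :
    Bpq p q (Pi.single i 1) (Pi.single j 1) =
      if i = j then (if i.val < p then (1 : ℝ) else -1) else 0 := by
  simp only [Bpq, LinearMap.mk₂_apply, Pi.single_apply]
  rw [Finset.sum_eq_single i]
  · simp
  · intro b _ hb
    simp [hb]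
  · simp

/-- The reflection as a linear map. -/
noncomputable def reflLin (p q : ℕ) (s : Fin (p + q) → ℝ) :
    (Fin (p + q) → ℝ) →ₗ[ℝ] (Fin (p + q) → ℝ) where
  toFun := reflpq p q s
  map_add' x y := by
    simp only [reflpq, map_add, LinearMap.add_apply]
    module
  map_smul' c x := by
    simp only [reflpq, map_smul, LinearMap.smul_apply, smul_eq_mul, RingHom.id_apply]
    module

theorem reflLin_orth (p q : ℕ) (s : Fin (p + q) → ℝ) (hs : Bpq p q s s ≠ 0)
    (x y : Fin (p + q) → ℝ) :
    Bpq p q (reflpq p q s x) (reflpq p q s y) = Bpq p q x y := by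
  simp only [reflpq, map_sub, map_smul, LinearMap.sub_apply, LinearMap.smul_apply, smul_eq_mul]
  rw [Bpq_symm p q s y]
  field_simp
  ring

theorem reflpq_invol (p q : ℕ) (s : Fin (p + q) → ℝ) (hs : Bpq p q s s ≠ 0)
    (x : Fin (p + q) → ℝ) : reflpq p q s (reflpq p q s x) = x := by
  have h : 2 * Bpq p q (reflpq p q s x) s / Bpq p q s s = - (2 * Bpq p q x s / Bpq p q s s) := by
    simp only [reflpq, map_sub, map_smul, LinearMap.sub_apply, LinearMap.smul_apply, smul_eq_mul]
    field_simp
    ring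
  rw [reflpq, h, reflpq]
  module

theorem reflpq_fix (p q : ℕ) (s x : Fin (p + q) → ℝ) (h : Bpq p q x s = 0) :
    reflpq p q s x = x := by
  simp [reflpq, h]

theorem reflpq_sub (p q : ℕ) (v w : Fin (p + q) → ℝ) (h : Bpq p q w w = Bpq p q v v)
    (hs : Bpq p q (v - w) (v - w) ≠ 0) : reflpq p q (v - w) w = v := by
  have h1 : 2 * Bpq p q w (v - w) / Bpq p q (v - w) (v - w) = -1 := by
    rw [div_eq_iff hs]
    simp only [map_sub, LinearMap.sub_apply]
    rw [Bpq_symm p q v w, h]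
    ring
  rw [reflpq, h1]
  module

theorem main_aux (p q : ℕ) (d : ℕ) : ∀ (T : (Fin (p + q) → ℝ) →ₗ[ℝ] (Fin (p + q) → ℝ)),
    d ≤ p + q →
    (∀ x y : Fin (p + q) → ℝ, Bpq p q (T x) (T y) = Bpq p q x y) →
    (∀ j : Fin (p + q), j.val + d < p + q → T (Pi.single j 1) = Pi.single j 1) →
    ∃ L : List (Fin (p + q) → ℝ), L.length ≤ 2 * d ∧ (∀ s ∈ L, Bpq p q s s ≠ 0) ∧
      ⇑T = (L.map (reflpq p q)).foldr (· ∘ ·) id := by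
  induction d with
  | zero =>
    intro T _ _ hfix
    refine ⟨[], by simp, by simp, ?_⟩
    have : T = LinearMap.id := by
      refine (Pi.basisFun ℝ (Fin (p + q))).ext fun j => ?_
      simpa using hfix j (by simp)
    rw [this]
    rfl
  | succ d ih =>
    intro T hd hT hfix
    obtain ⟨m, hm⟩ : ∃ m : Fin (p + q), m.val + (d + 1) = p + q :=
      ⟨⟨p + q - (d + 1), by omega⟩, by simp; omega⟩
    set v : Fin (p + q) → ℝ := Pi.single m 1 with hv
    have hvv : Bpq p q v v ≠ 0 := by
      rw [hv, Bpq_single]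
      split_ifs <;> simp_all
    have hww : Bpq p q (T v) (T v) = Bpq p q v v := hT v v
    have hjv : ∀ j : Fin (p + q), j.val + (d + 1) < p + q → Bpq p q (Pi.single j 1) v = 0 := by
      intro j hj
      rw [hv, Bpq_single, if_neg]
      rintro rfl
      omega
    have hjw : ∀ j : Fin (p + q), j.val + (d + 1) < p + q →
        Bpq p q (Pi.single j 1) (T v) = 0 := by
      intro j hj
      have := hT (Pi.single j 1) v
      rwa [hfix j hj, hjv j hj] at this
    by_cases h1 : Bpq p q (v - T v) (v - T v) = 0
    · have h2 : Bpq p q (-v - T v) (-v - T v) ≠ 0 := by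
        intro h2
        apply hvv
        simp only [map_sub, map_neg, LinearMap.sub_apply, LinearMap.neg_apply] at h1 h2
        linarith
      have h3 : reflpq p q (-v - T v) (T v) = -v :=
        reflpq_sub p q (-v) (T v) (by simpa using hww) h2
      have h4 : reflpq p q v (-v) = v := by
        simp only [reflpq, map_neg, LinearMap.neg_apply]
        have : 2 * -(Bpq p q v v) / Bpq p q v v = -2 := by field_simp
        rw [this]
        module
      obtain ⟨L, hL, hL2, hL3⟩ := ih (reflLin p q v ∘ₗ reflLin p q (-v - T v) ∘ₗ T) (by omega)
        (fun x y => by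
          change Bpq p q (reflpq p q v (reflpq p q _ (T x)))
            (reflpq p q v (reflpq p q _ (T y))) = _
          rw [reflLin_orth p q _ hvv, reflLin_orth p q _ h2, hT])
        (fun j hj => by
          change reflpq p q v (reflpq p q _ (T _)) = _
          rcases Nat.lt_or_ge (j.val + (d + 1)) (p + q) with h | h
          · rw [hfix j h, reflpq_fix p q (-v - T v), reflpq_fix]
            · exact hjv j h
            · simp [hjv j h, hjw j h]
          · obtain rfl : j = m := Fin.ext (by omega)
            rw [← hv, h3, h4])
      refine ⟨(-v - T v) :: v :: L, by simp; omega, ?_, ?_⟩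
      · intro s hs
        simp only [List.mem_cons] at hs
        rcases hs with rfl | rfl | hs
        · exact h2
        · exact hvv
        · exact hL2 s hs
      · simp only [List.map_cons, List.foldr_cons]
        rw [← hL3]
        funext x
        change T x = reflpq p q _ (reflpq p q v (reflpq p q v (reflpq p q _ (T x))))
        rw [reflpq_invol p q v hvv, reflpq_invol p q _ h2]
    · obtain ⟨L, hL, hL2, hL3⟩ := ih (reflLin p q (v - T v) ∘ₗ T) (by omega)
        (fun x y => by
          change Bpq p q (reflpq p q _ (T x)) (reflpq p q _ (T y)) = _
          rw [reflLin_orth p q _ h1, hT])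
        (fun j hj => by
          change reflpq p q _ (T _) = _
          rcases Nat.lt_or_ge (j.val + (d + 1)) (p + q) with h | h
          · rw [hfix j h, reflpq_fix]
            simp [hjv j h, hjw j h]
          · obtain rfl : j = m := Fin.ext (by omega)
            exact reflpq_sub p q v (T v) hww h1)
      refine ⟨(v - T v) :: L, by simp; omega, ?_, ?_⟩
      · intro s hs
        simp only [List.mem_cons] at hs
        rcases hs with rfl | hs
        · exact h1
        · exact hL2 s hs
      · simp only [List.map_cons, List.foldr_cons]
        rw [← hL3]
        funext x
        change T x = reflpq p q _ (reflpq p q _ (T x))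
        rw [reflpq_invol p q _ h1]

/-- every orthogonal transformation of `ℝ^{p,q}` is the composition of
at most `2 * (p + q)` hyperplane reflections (the empty composition being the
identity). -/
theorem stmt_5 (p q : ℕ) (T : (Fin (p + q) → ℝ) →ₗ[ℝ] (Fin (p + q) → ℝ))
    (horth : ∀ x y : Fin (p + q) → ℝ, Bpq p q (T x) (T y) = Bpq p q x y) :
    ∃ (k : ℕ) (s : Fin k → (Fin (p + q) → ℝ)), k ≤ 2 * (p + q) ∧
      (∀ i, Bpq p q (s i) (s i) ≠ 0) ∧
      ⇑T = (List.ofFn fun i => reflpq p q (s i)).foldr (· ∘ ·) id := by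
  obtain ⟨L, hL, hL2, hL3⟩ := main_aux p q (p + q) T le_rfl horth (fun j hj => by omega)
  refine ⟨L.length, L.get, hL, fun i => hL2 _ (L.get_mem i), ?_⟩
  rw [hL3]
  congr 1
  apply List.ext_get <;> simp
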